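/- For the Lie algebra 𝔤₄,₁, the fundamental tensors satisfy: F₁(e₁,e₄,e₁) = F₁(e₂,e₁,e₃) = F₁(e₃,e₄,e₁) = F₁(e₄,e₁,e₃) = ½; F₂(e₂,e₁,e₂) = F₂(e₂,e₂,e₃) = F₂(e₄,e₁,e₄) = ½, F₂(e₄,e₁,e₂) = −½, F₂(e₁,e₂,e₂) = F₂(e₃,e₂,e₂) = 1; F₃(e₁,e₃,e₄) = F₃(e₃,e₃,e₄) = F₃(e₄,e₁,e₃) = ½, F₃(e₂,e₁,e₃) = −½, F₃(e₂,e₁,e₁) = F₃(e₄,e₂,e₂) = −1; and the Lee forms satisfy θ₁(e₂) = θ₂(e₃) = 1, θ₃(e₂) = θ₃(e₄) = −1, with all other values θ_α(eᵢ) equal to zero. -/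

import Mathlib

noncomputable section

/-- The underlying 4-dimensional real vector space. -/
abbrev V : Type := Fin 4 → ℝ

/-- The standard basis e₁,e₂,e₃,e₄ (indexed by 0,1,2,3). -/
def e (i : Fin 4) : V := Pi.single i 1

/-- The neutral metric g with g(e₁,e₁)=g(e₂,e₂)=1, g(e₃,e₃)=g(e₄,e₄)=−1. -/
def gm (x y : V) : ℝ := x 0 * y 0 + x 1 * y 1 - x 2 * y 2 - x 3 * y 3

/-- The signs ε₁=ε₂=1, ε₃=ε₄=−1. -/
def eps : Fin 4 → ℝ := ![1, 1, -1, -1]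

/-- J₁ : e₁↦e₂, e₂↦−e₁, e₃↦−e₄, e₄↦e₃. -/
def J1 (x : V) : V := ![-x 1, x 0, x 3, -x 2]

/-- J₂ : e₁↦e₃, e₂↦e₄, e₃↦−e₁, e₄↦−e₂. -/
def J2 (x : V) : V := ![-x 2, -x 3, x 0, x 1]

/-- J₃ : e₁↦−e₄, e₂↦e₃, e₃↦−e₂, e₄↦e₁. -/
def J3 (x : V) : V := ![x 3, -x 2, x 1, -x 0]

/-- Lie bracket of 𝔤₄,₁ : [e₂,e₄]=e₁, [e₃,e₄]=e₂. -/
def br (x y : V) : V := ![x 1 * y 3 - x 3 * y 1, x 2 * y 3 - x 3 * y 2, 0, 0]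

/-- Fundamental tensor F(x,y,z) = g((∇ₓ J)y, z) for an almost complex structure Jm. -/
def Fa (nab : V →ₗ[ℝ] V →ₗ[ℝ] V) (Jm : V → V) (x y z : V) : ℝ :=
  gm (nab x (Jm y) - Jm (nab x y)) z

/-- Lee form θ(z) = Σᵢ εᵢ F(eᵢ,eᵢ,z). -/
def theta (nab : V →ₗ[ℝ] V →ₗ[ℝ] V) (Jm : V → V) : V → ℝ :=
  fun z => ∑ i, eps i * Fa nab Jm (e i) (e i) z

/-- Curvature operator R(x,y)z = ∇ₓ∇_y z − ∇_y∇ₓ z − ∇_{[x,y]} z. -/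
def Rm (nab : V →ₗ[ℝ] V →ₗ[ℝ] V) (x y z : V) : V :=
  nab x (nab y z) - nab y (nab x z) - nab (br x y) z

/-- Curvature (0,4)-tensor R(x,y,z,w) = g(R(x,y)z, w). -/
def R4 (nab : V →ₗ[ℝ] V →ₗ[ℝ] V) (x y z w : V) : ℝ := gm (Rm nab x y z) w

/-- Ricci tensor ρ(y,z) = Σᵢ εᵢ R(eᵢ,y,z,eᵢ). -/
def ricci (nab : V →ₗ[ℝ] V →ₗ[ℝ] V) (y z : V) : ℝ :=
  ∑ i, eps i * R4 nab (e i) y z (e i)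

/-- Scalar curvature τ = Σⱼ εⱼ ρ(eⱼ,eⱼ). -/
def tau (nab : V →ₗ[ℝ] V →ₗ[ℝ] V) : ℝ := ∑ j, eps j * ricci nab (e j) (e j)

/-- Associated Ricci tensor ρ*(y,z) = Σᵢ εᵢ R(eᵢ,y,z,J eᵢ). -/
def ricciS (nab : V →ₗ[ℝ] V →ₗ[ℝ] V) (Jm : V → V) (y z : V) : ℝ :=
  ∑ i, eps i * R4 nab (e i) y z (Jm (e i))

/-- ∗-scalar curvature τ* = Σⱼ εⱼ ρ*(eⱼ,eⱼ). -/
def tauS (nab : V →ₗ[ℝ] V →ₗ[ℝ] V) (Jm : V → V) : ℝ :=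
  ∑ j, eps j * ricciS nab Jm (e j) (e j)

/-- ∗∗-scalar curvature τ** = Σⱼ εⱼ ρ*(eⱼ,J eⱼ). -/
def tauSS (nab : V →ₗ[ℝ] V →ₗ[ℝ] V) (Jm : V → V) : ℝ :=
  ∑ j, eps j * ricciS nab Jm (e j) (Jm (e j))

/-- Basic sectional curvature k_{ij} = R(eᵢ,eⱼ,eⱼ,eᵢ)/(εᵢεⱼ). -/
def sek (nab : V →ₗ[ℝ] V →ₗ[ℝ] V) (i j : Fin 4) : ℝ :=
  R4 nab (e i) (e j) (e j) (e i) / (eps i * eps j)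

/-- Antisymmetrized Kronecker symbol used to encode curvature-type tensors. -/
def D (a b i j : Fin 4) : ℝ :=
  (if i = a ∧ j = b then (1 : ℝ) else 0) - (if i = b ∧ j = a then (1 : ℝ) else 0)

lemma e_zero : e 0 = ![1, 0, 0, 0] := by
  ext j
  fin_cases j <;> simp [e]

lemma e_one : e 1 = ![0, 1, 0, 0] := by
  ext j
  fin_cases j <;> simp [e]

lemma e_two : e 2 = ![0, 0, 1, 0] := by
  ext j
  fin_cases j <;> simp [e]

lemma e_three : e 3 = ![0, 0, 0, 1] := by
  ext j
  fin_cases j <;> simp [e]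

/-- The explicit form of a bilinear map satisfying the Koszul formula on 𝔤₄,₁. -/
lemma nab_eq_of_koszul (nab : V →ₗ[ℝ] V →ₗ[ℝ] V)
    (hK : ∀ x y z : V, 2 * gm (nab x y) z = gm (br x y) z + gm (br z x) y + gm (br z y) x)
    (x y : V) :
    nab x y = ![(x 1 * y 3 - x 3 * y 1) / 2,
      (x 2 * y 3 - x 3 * y 2 + x 3 * y 0 + x 0 * y 3) / 2,
      -(x 3 * y 1 + x 1 * y 3) / 2,
      (x 1 * y 0 + x 2 * y 1 + x 0 * y 1 + x 1 * y 2) / 2] := by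
  have h0 := hK x y (e 0)
  have h1 := hK x y (e 1)
  have h2 := hK x y (e 2)
  have h3 := hK x y (e 3)
  simp [gm, br, e] at h0 h1 h2 h3
  ext i
  fin_cases i <;> simp <;> linarith

theorem stmt_1
    (nab : V →ₗ[ℝ] V →ₗ[ℝ] V)
    (hK : ∀ x y z : V, 2 * gm (nab x y) z = gm (br x y) z + gm (br z x) y + gm (br z y) x) :
    Fa nab J1 (e 0) (e 3) (e 0) = 1/2 ∧
    Fa nab J1 (e 1) (e 0) (e 2) = 1/2 ∧
    Fa nab J1 (e 2) (e 3) (e 0) = 1/2 ∧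
    Fa nab J1 (e 3) (e 0) (e 2) = 1/2 ∧
    Fa nab J2 (e 1) (e 0) (e 1) = 1/2 ∧
    Fa nab J2 (e 1) (e 1) (e 2) = 1/2 ∧
    Fa nab J2 (e 3) (e 0) (e 3) = 1/2 ∧
    Fa nab J2 (e 3) (e 0) (e 1) = -(1/2) ∧
    Fa nab J2 (e 0) (e 1) (e 1) = 1 ∧
    Fa nab J2 (e 2) (e 1) (e 1) = 1 ∧
    Fa nab J3 (e 0) (e 2) (e 3) = 1/2 ∧
    Fa nab J3 (e 2) (e 2) (e 3) = 1/2 ∧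
    Fa nab J3 (e 3) (e 0) (e 2) = 1/2 ∧
    Fa nab J3 (e 1) (e 0) (e 2) = -(1/2) ∧
    Fa nab J3 (e 1) (e 0) (e 0) = -1 ∧
    Fa nab J3 (e 3) (e 1) (e 1) = -1 ∧
    theta nab J1 (e 1) = 1 ∧ theta nab J2 (e 2) = 1 ∧
    theta nab J3 (e 1) = -1 ∧ theta nab J3 (e 3) = -1 ∧
    theta nab J1 (e 0) = 0 ∧ theta nab J1 (e 2) = 0 ∧ theta nab J1 (e 3) = 0 ∧
    theta nab J2 (e 0) = 0 ∧ theta nab J2 (e 1) = 0 ∧ theta nab J2 (e 3) = 0 ∧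
    theta nab J3 (e 0) = 0 ∧ theta nab J3 (e 2) = 0
  := by
    have hn := nab_eq_of_koszul nab hK
    simp only [theta, Fin.sum_univ_four, Fa, hn, e_zero, e_one, e_two, e_three]
    refine ⟨?_, ?_, ?_, ?_, ?_, ?_, ?_, ?_, ?_, ?_, ?_, ?_, ?_, ?_, ?_, ?_, ?_, ?_, ?_, ?_, ?_, ?_,
      ?_, ?_, ?_, ?_, ?_, ?_⟩ <;>
      simp [gm, eps, J1, J2, J3] <;> norm_num
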